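/- arXiv:1704.08482 — 3 statements merged into one kernel-verified Lean document; each statement's English description precedes it below -/
import Mathlib

section
/- Let n ≥ 1 and let X = (x_{i,j}) be an n×n integer matrix with all entries in {-1, 0, 1}. Then there exists an (n+2)×(n+2) integer matrix Z = (z_{i,j}) with all entries in {-1, 0, 1} such that: (i) z_{n+2,n+2} = 0; (ii) Per(Z) = -Per(X); and (iii) Per(Z^{n+2,n+2}) = Per(X^{1,1}). -/
/-- The minor of a square matrix obtained by deleting row `i` and column `j`. -/
def matMinor {n : ℕ} (M : Matrix (Fin (n + 1)) (Fin (n + 1)) ℤ) (i j : Fin (n + 1)) :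
    Matrix (Fin n) (Fin n) ℤ :=
  M.submatrix i.succAbove j.succAbove

namespace Matrix

variable {R : Type*} [CommSemiring R] {n : ℕ}

theorem permanent_eq_mul_of_col_zero (A : Matrix (Fin (n + 1)) (Fin (n + 1)) R)
    (h : ∀ i : Fin n, A i.succ 0 = 0) :
    A.permanent = A 0 0 * (A.submatrix Fin.succ Fin.succ).permanent := by
  rw [permanent, Finset.univ_perm_fin_succ, ← Finset.univ_product_univ]
  simp only [Finset.sum_map, Equiv.toEmbedding_apply, Finset.sum_product, Fin.sum_univ_succ,
    Fin.prod_univ_succ, Equiv.Perm.decomposeFin_symm_apply_zero,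
    Equiv.Perm.decomposeFin_symm_apply_succ, h, zero_mul, Finset.sum_const_zero, add_zero,
    Equiv.swap_self, Equiv.refl_apply, permanent, submatrix_apply, Finset.mul_sum]

/-- Laplace expansion of the permanent along a column with a single nonzero entry. -/
theorem permanent_eq_mul_of_col (A : Matrix (Fin (n + 1)) (Fin (n + 1)) R) (i j : Fin (n + 1))
    (h : ∀ k, k ≠ i → A k j = 0) :
    A.permanent = A i j * (A.submatrix i.succAbove j.succAbove).permanent := by
  rw [← permanent_permute_cols i.cycleRange.symm A, ← permanent_permute_rows j.cycleRange.symm,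
    permanent_eq_mul_of_col_zero]
  · simp [submatrix_submatrix, Function.comp_def]
  · intro k
    simpa using h _ (Fin.succAbove_ne i k)

/-- Laplace expansion of the permanent along a row with a single nonzero entry. -/
theorem permanent_eq_mul_of_row (A : Matrix (Fin (n + 1)) (Fin (n + 1)) R) (i j : Fin (n + 1))
    (h : ∀ k, k ≠ j → A i k = 0) :
    A.permanent = A i j * (A.submatrix i.succAbove j.succAbove).permanent := by
  rw [← permanent_transpose, permanent_eq_mul_of_col Aᵀ j i h, ← transpose_submatrix,
    permanent_transpose, transpose_apply]

/-- The matrix `X` bordered by two rows and two columns: the row `(1, 0, …, 0)` on top, the row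
`(0, 1, 0, …, 0, -1)` below it, and the first row of `X` moved to the bottom. -/
def border (X : Matrix (Fin (n + 1)) (Fin (n + 1)) ℤ) : Matrix (Fin (n + 3)) (Fin (n + 3)) ℤ :=
  of (Fin.snoc (α := fun _ => Fin (n + 3) → ℤ)
    (Fin.cons (Pi.single 0 1)
      (Fin.cons (Fin.snoc (α := fun _ => ℤ) (Fin.cons 0 (Pi.single 0 1)) (-1))
        fun i => Fin.snoc (α := fun _ => ℤ) (Fin.cons 0 (X i.succ)) 0))
    (Fin.snoc (α := fun _ => ℤ) (Fin.cons 0 (X 0)) 0))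

variable (X : Matrix (Fin (n + 1)) (Fin (n + 1)) ℤ)

theorem border_last : border X (Fin.last (n + 2)) =
    Fin.snoc (α := fun _ => ℤ) (Fin.cons 0 (X 0)) 0 := by
  funext j
  simp only [border, of_apply, Fin.snoc_last]

theorem border_zero : border X 0 = Pi.single 0 1 := by
  change border X (Fin.castSucc 0) = _
  funext j
  simp only [border, of_apply, Fin.snoc_castSucc, Fin.cons_zero]

theorem border_one : border X (Fin.succ 0).castSucc =
    Fin.snoc (α := fun _ => ℤ) (Fin.cons 0 (Pi.single 0 1)) (-1) := by
  funext j
  simp only [border, of_apply, Fin.snoc_castSucc, Fin.cons_succ, Fin.cons_zero]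

theorem border_succ_succ (i : Fin n) : border X i.succ.succ.castSucc =
    Fin.snoc (α := fun _ => ℤ) (Fin.cons 0 (X i.succ)) 0 := by
  funext j
  simp only [border, of_apply, Fin.snoc_castSucc, Fin.cons_succ]

theorem border_mem (hX : ∀ i j, X i j = -1 ∨ X i j = 0 ∨ X i j = 1) (i j : Fin (n + 3)) :
    border X i j = -1 ∨ border X i j = 0 ∨ border X i j = 1 := by
  have single (m : ℕ) (k : Fin (m + 1)) :
      (Pi.single 0 1 : Fin (m + 1) → ℤ) k = 0 ∨ (Pi.single 0 1 : Fin (m + 1) → ℤ) k = 1 := by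
    rw [Pi.single_apply]
    split_ifs <;> simp
  have pad (v : Fin (n + 1) → ℤ) (b : ℤ) (hv : ∀ k, v k = -1 ∨ v k = 0 ∨ v k = 1)
      (hb : b = -1 ∨ b = 0 ∨ b = 1) (k : Fin (n + 3)) :
      (Fin.snoc (α := fun _ => ℤ) (Fin.cons 0 v) b : Fin (n + 3) → ℤ) k = -1 ∨
      (Fin.snoc (α := fun _ => ℤ) (Fin.cons 0 v) b : Fin (n + 3) → ℤ) k = 0 ∨
      (Fin.snoc (α := fun _ => ℤ) (Fin.cons 0 v) b : Fin (n + 3) → ℤ) k = 1 := by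
    refine Fin.lastCases ?_ (fun k => Fin.cases ?_ (fun k => ?_) k) k
    · simpa only [Fin.snoc_last] using hb
    · simp only [Fin.snoc_castSucc, Fin.cons_zero, true_or, or_true]
    · simpa only [Fin.snoc_castSucc, Fin.cons_succ] using hv k
  refine Fin.lastCases ?_ (fun i => Fin.cases ?_ (fun i => Fin.cases ?_ (fun i => ?_) i) i) i
  · rw [border_last]
    exact pad _ _ (hX 0) (by simp) j
  · rw [Fin.castSucc_zero, border_zero]
    exact Or.inr (single _ j)
  · rw [border_one]
    exact pad _ _ (fun k => Or.inr (single _ k)) (by simp) j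
  · rw [border_succ_succ]
    exact pad _ _ (hX i.succ) (by simp) j

theorem permanent_border : (border X).permanent = -X.permanent := by
  rw [permanent_eq_mul_of_row _ 0 0 fun k hk => by rw [border_zero, Pi.single_eq_of_ne hk],
    permanent_eq_mul_of_col _ 0 (Fin.last (n + 1)), submatrix_submatrix,
    ← permanent_permute_cols (finRotate (n + 1)) X]
  · have h : border X (Fin.succ 0) = _ := border_one X
    have hm : (border X).submatrix (Fin.succ ∘ Fin.succ) (Fin.succ ∘ Fin.castSucc) =
        X.submatrix (finRotate (n + 1)) id := by
      ext i j
      simp only [submatrix_apply, Function.comp_apply, id, Fin.succ_castSucc]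
      refine Fin.lastCases ?_ (fun i => ?_) i
      · rw [Fin.succ_last, Fin.succ_last, border_last, Fin.snoc_castSucc, Fin.cons_succ,
          finRotate_last]
      · rw [Fin.succ_castSucc, Fin.succ_castSucc, border_succ_succ, Fin.snoc_castSucc,
          Fin.cons_succ, finRotate_apply, Fin.coeSucc_eq_succ]
    simp only [Fin.succAbove_zero, Fin.succAbove_last, hm, submatrix_apply, border_zero,
      Pi.single_eq_same, Fin.succ_last, h, Fin.snoc_last]
    ring
  · intro k hk
    obtain ⟨k, rfl⟩ := Fin.exists_succ_eq.2 hk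
    simp only [Fin.succAbove_zero, submatrix_apply, Fin.succ_last]
    refine Fin.lastCases ?_ (fun k => ?_) k
    · rw [Fin.succ_last, Fin.succ_last, border_last, Fin.snoc_last]
    · rw [Fin.succ_castSucc, Fin.succ_castSucc, border_succ_succ, Fin.snoc_last]

theorem permanent_submatrix_border : ((border X).submatrix Fin.castSucc Fin.castSucc).permanent =
    (X.submatrix Fin.succ Fin.succ).permanent := by
  rw [permanent_eq_mul_of_row _ 0 0, permanent_eq_mul_of_row _ 0 0]
  · have hm : (border X).submatrix (Fin.castSucc ∘ Fin.succ ∘ Fin.succ)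
        (Fin.castSucc ∘ Fin.succ ∘ Fin.succ) = X.submatrix Fin.succ Fin.succ := by
      ext i j
      simp only [submatrix_apply, Function.comp_apply]
      rw [border_succ_succ, Fin.snoc_castSucc, Fin.cons_succ]
    simp only [submatrix_submatrix, submatrix_apply, Fin.succAbove_zero, Function.comp_assoc, hm,
      border_one, Fin.castSucc_zero, border_zero, Fin.snoc_castSucc, Fin.cons_succ,
      Pi.single_eq_same, one_mul]
  · intro k hk
    simp only [Fin.succAbove_zero, submatrix_apply]
    rw [border_one, Fin.snoc_castSucc, Fin.cons_succ, Pi.single_eq_of_ne hk]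
  · intro k hk
    rw [submatrix_apply, Fin.castSucc_zero, border_zero, Pi.single_eq_of_ne]
    simpa using hk

end Matrix

/-- For every `(n+1) × (n+1)` integer matrix `X` (so of size `≥ 1`) with
entries in `{-1, 0, 1}`, there is an `(n+3) × (n+3)` matrix `Z` with entries in `{-1, 0, 1}`
whose bottom-right entry is `0`, whose permanent is `-Per(X)`, and such that deleting the last
row and column of `Z` yields a matrix whose permanent equals that of `X` with its first row
and column deleted. -/
theorem stmt0 (n : ℕ) (X : Matrix (Fin (n + 1)) (Fin (n + 1)) ℤ)
    (hX : ∀ i j, X i j = -1 ∨ X i j = 0 ∨ X i j = 1) :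
    ∃ Z : Matrix (Fin (n + 3)) (Fin (n + 3)) ℤ,
      (∀ i j, Z i j = -1 ∨ Z i j = 0 ∨ Z i j = 1) ∧
      Z (Fin.last (n + 2)) (Fin.last (n + 2)) = 0 ∧
      Z.permanent = -X.permanent ∧
      (matMinor Z (Fin.last (n + 2)) (Fin.last (n + 2))).permanent
        = (matMinor X 0 0).permanent := by
  refine ⟨X.border, X.border_mem hX, ?_, X.permanent_border, ?_⟩
  · rw [Matrix.border_last, Fin.snoc_last]
  · simpa only [matMinor, Fin.succAbove_last, Fin.succAbove_zero] using
      X.permanent_submatrix_border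
end

section
/- Let n ≥ 1, m ≥ 2, let X = (x_{i,j}) be an n×n integer matrix with all entries in {-1, 0, 1}, and let Z = (z_{i,j}) be an m×m integer matrix with all entries in {-1, 0, 1} satisfying z_{m,m} = 0. Define the (m+n-1)×(m+n-1) matrix W = (w_{i,j}) by: w_{i,j} = z_{i,j} for 1 ≤ i ≤ m−1 and 1 ≤ j ≤ m; w_{i,j} = 0 for 1 ≤ i ≤ m−1 and j > m; w_{m,j} = z_{m,j} for 1 ≤ j ≤ m−1; w_{m+i−1, m+j−1} = x_{i,j} for 1 ≤ i, j ≤ n; and w_{i,j} = 0 for i > m and j ≤ m−1. Then Per(W) = Per(Z)·Per(X^{1,1}) + Per(Z^{m,m})·Per(X). -/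
/-- The `(m+n-1) × (m+n-1)` matrix `W` built (in 0-based indexing) from an `m × m` matrix `Z`
(with `m = μ+2`) and an `n × n` matrix `X` (with `n = ν+1`): the top-left block is `Z` (minus
its bottom-right `0` entry), the bottom-right block is `X`, overlapping in the single entry
`x_{1,1}`, and all other entries vanish. -/
def blockW (μ ν : ℕ) (Z : Matrix (Fin (μ + 2)) (Fin (μ + 2)) ℤ)
    (X : Matrix (Fin (ν + 1)) (Fin (ν + 1)) ℤ) :
    Matrix (Fin (μ + ν + 2)) (Fin (μ + ν + 2)) ℤ :=
  fun i j =>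
    if hi : (i : ℕ) < μ + 1 then
      if hj : (j : ℕ) < μ + 2 then Z ⟨i, by omega⟩ ⟨j, hj⟩ else 0
    else
      if hj : (j : ℕ) < μ + 1 then
        if (i : ℕ) = μ + 1 then Z ⟨μ + 1, by omega⟩ ⟨j, by omega⟩ else 0
      else
        X ⟨(i : ℕ) - (μ + 1), by have := i.isLt; omega⟩
          ⟨(j : ℕ) - (μ + 1), by have := j.isLt; omega⟩

namespace Matrix

variable {m n R : Type*} [DecidableEq m] [Fintype m] [DecidableEq n] [Fintype n] [CommSemiring R]

theorem permanent_submatrix_equiv_self (e : n ≃ m) (A : Matrix m m R) :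
    (A.submatrix e e).permanent = A.permanent := by
  refine Fintype.sum_equiv (Equiv.permCongr e) _ _ fun σ => Fintype.prod_equiv e _ _ fun i => ?_
  rw [Equiv.permCongr_apply, Equiv.symm_apply_apply, submatrix_apply]

theorem permanent_updateCol_add (M : Matrix n n R) (j : n) (u v : n → R) :
    (M.updateCol j (u + v)).permanent =
      (M.updateCol j u).permanent + (M.updateCol j v).permanent := by
  simp only [permanent, ← Finset.mul_prod_erase _ _ (Finset.mem_univ j), updateCol_self,
    Pi.add_apply, ← Finset.sum_add_distrib, add_mul]
  refine Finset.sum_congr rfl fun σ _ => ?_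
  have h (w : n → R) : ∏ i ∈ Finset.univ.erase j, M.updateCol j w (σ i) i =
      ∏ i ∈ Finset.univ.erase j, M (σ i) i :=
    Finset.prod_congr rfl fun i hi => updateCol_ne (Finset.ne_of_mem_erase hi)
  simp only [h]

theorem permanent_updateRow_add (M : Matrix n n R) (i : n) (u v : n → R) :
    (M.updateRow i (u + v)).permanent =
      (M.updateRow i u).permanent + (M.updateRow i v).permanent := by
  simp only [← permanent_transpose (M.updateRow i _), ← updateCol_transpose,
    permanent_updateCol_add]

theorem permanent_fromBlocks_zero₂₁ (A : Matrix m m R) (B : Matrix m n R) (D : Matrix n n R) :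
    (fromBlocks A B 0 D).permanent = A.permanent * D.permanent := by
  classical
  simp only [permanent, Finset.sum_mul_sum, ← Finset.sum_product', Finset.univ_product_univ]
  symm
  refine Finset.sum_of_injOn (Equiv.Perm.sumCongrHom m n)
    (Equiv.Perm.sumCongrHom_injective.injOn) (by simp) ?_ ?_
  · intro σ _ hσ
    have hmaps : ¬ Set.MapsTo σ (Set.range Sum.inl) (Set.range Sum.inl) := by
      intro h
      obtain ⟨τ, hτ⟩ := Equiv.Perm.mem_sumCongrHom_range_of_perm_mapsTo_inl h
      exact hσ ⟨τ, by simp, hτ⟩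
    simp only [Set.MapsTo, Set.mem_range, forall_exists_index, forall_apply_eq_imp_iff,
      not_forall] at hmaps
    obtain ⟨a, ha⟩ := hmaps
    refine Finset.prod_eq_zero (Finset.mem_univ (Sum.inl a)) ?_
    rcases hx : σ (Sum.inl a) with a' | b
    · exact absurd ⟨a', hx.symm⟩ ha
    · simp
  · rintro ⟨σ, τ⟩ _
    simp [Fintype.prod_sum_type]

theorem permanent_fromBlocks_zero₁₂ (A : Matrix m m R) (C : Matrix n m R) (D : Matrix n n R) :
    (fromBlocks A 0 C D).permanent = A.permanent * D.permanent := by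
  rw [← permanent_transpose, fromBlocks_transpose, transpose_zero, permanent_fromBlocks_zero₂₁,
    permanent_transpose, permanent_transpose]

end Matrix

open Matrix in
/-- Keeping only the `Z`-part of the shared row of `blockW` leaves a block triangular matrix with
diagonal blocks `Z` and `X` without its first row and column. -/
theorem permanent_blockW_updateRow_left (μ ν : ℕ) (Z : Matrix (Fin (μ + 2)) (Fin (μ + 2)) ℤ)
    (X : Matrix (Fin (ν + 1)) (Fin (ν + 1)) ℤ)
    (hZ : Z (Fin.last (μ + 1)) (Fin.last (μ + 1)) = 0) (r : Fin (μ + ν + 2))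
    (hr : (r : ℕ) = μ + 1) :
    ((blockW μ ν Z X).updateRow r
      (fun j => if (j : ℕ) < μ + 1 then blockW μ ν Z X r j else 0)).permanent =
      Z.permanent * (matMinor X 0 0).permanent := by
  set M := (blockW μ ν Z X).updateRow r
    (fun j => if (j : ℕ) < μ + 1 then blockW μ ν Z X r j else 0) with hM
  let e : Fin (μ + 2) ⊕ Fin ν ≃ Fin (μ + ν + 2) :=
    finSumFinEquiv.trans (finCongr (by omega))
  have hl (i : Fin (μ + 2)) : (e (Sum.inl i) : ℕ) = i := by simp [e]
  have hr' (i : Fin ν) : (e (Sum.inr i) : ℕ) = μ + 2 + i := by simp [e]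
  have key : M.submatrix e e =
      fromBlocks Z 0 (M.submatrix e e).toBlocks₂₁ (matMinor X 0 0) := by
    ext i j
    rcases i with i | i <;> rcases j with j | j
    · simp only [hM, submatrix_apply, fromBlocks_apply₁₁, updateRow_apply, Fin.ext_iff, hl, hr,
        blockW]
      have hi := i.isLt
      have hj := j.isLt
      by_cases h : (i : ℕ) = μ + 1
      · obtain rfl : i = Fin.last (μ + 1) := Fin.ext h
        by_cases h' : (j : ℕ) = μ + 1
        · obtain rfl : j = Fin.last (μ + 1) := Fin.ext h'
          simp [hZ]
        · have : (j : ℕ) < μ + 1 := by omega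
          simp [this]
          rfl
      · have : (i : ℕ) < μ + 1 := by omega
        simp [h, this]
    · simp only [hM, submatrix_apply, fromBlocks_apply₁₂, updateRow_apply, Fin.ext_iff, hl, hr,
        hr', blockW, Matrix.zero_apply]
      have hi := i.isLt
      split_ifs <;> first | rfl | omega
    · simp [toBlocks₂₁]
    · have h₁ (a : Fin ν) : μ + 2 + (a : ℕ) - (μ + 1) = a + 1 := by omega
      have h₂ (a : Fin ν) : ¬ μ + 2 + (a : ℕ) < μ + 1 := by omega
      have h₃ : μ + 2 + (i : ℕ) ≠ μ + 1 := by omega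
      simp only [hM, submatrix_apply, fromBlocks_apply₂₂, updateRow_apply, Fin.ext_iff, hr,
        hr', blockW, matMinor, h₁, h₂, h₃, if_false, dif_neg, not_false_eq_true]
      rfl
  rw [← permanent_submatrix_equiv_self e, key, permanent_fromBlocks_zero₁₂]

open Matrix in
/-- Keeping only the `X`-part of the shared row of `blockW` leaves a block triangular matrix with
diagonal blocks `Z` without its last row and column, and `X`. -/
theorem permanent_blockW_updateRow_right (μ ν : ℕ) (Z : Matrix (Fin (μ + 2)) (Fin (μ + 2)) ℤ)
    (X : Matrix (Fin (ν + 1)) (Fin (ν + 1)) ℤ) (r : Fin (μ + ν + 2)) (hr : (r : ℕ) = μ + 1) :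
    ((blockW μ ν Z X).updateRow r
      (fun j => if (j : ℕ) < μ + 1 then 0 else blockW μ ν Z X r j)).permanent =
      (matMinor Z (Fin.last (μ + 1)) (Fin.last (μ + 1))).permanent * X.permanent := by
  set M := (blockW μ ν Z X).updateRow r
    (fun j => if (j : ℕ) < μ + 1 then 0 else blockW μ ν Z X r j) with hM
  let e : Fin (μ + 1) ⊕ Fin (ν + 1) ≃ Fin (μ + ν + 2) :=
    finSumFinEquiv.trans (finCongr (by omega))
  have hl (i : Fin (μ + 1)) : (e (Sum.inl i) : ℕ) = i := by simp [e]
  have hr' (i : Fin (ν + 1)) : (e (Sum.inr i) : ℕ) = μ + 1 + i := by simp [e]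
  have key : M.submatrix e e =
      fromBlocks (matMinor Z (Fin.last (μ + 1)) (Fin.last (μ + 1)))
        (M.submatrix e e).toBlocks₁₂ 0 X := by
    ext i j
    rcases i with i | i <;> rcases j with j | j
    · have hi := i.isLt
      have hj : (j : ℕ) < μ + 2 := by omega
      have h : (i : ℕ) ≠ μ + 1 := by omega
      simp only [hM, submatrix_apply, fromBlocks_apply₁₁, updateRow_apply, Fin.ext_iff, hl, hr,
        blockW, matMinor, hi, hj, h, if_false, dif_pos, Fin.succAbove_last]
      rfl
    · simp [toBlocks₁₂]
    · have hj := j.isLt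
      simp only [hM, submatrix_apply, fromBlocks_apply₂₁, updateRow_apply, Fin.ext_iff, hl, hr,
        hr', blockW, Matrix.zero_apply]
      split_ifs <;> first | rfl | omega
    · simp only [hM, submatrix_apply, fromBlocks_apply₂₂, updateRow_apply, Fin.ext_iff, hr,
        hr', blockW]
      have hlt (k : Fin (ν + 1)) : ¬ μ + 1 + (k : ℕ) ≤ μ := by omega
      by_cases h : (i : ℕ) = 0
      · obtain rfl : i = 0 := Fin.ext h
        simp [hlt]
      · simp [h, hlt]
  rw [← permanent_submatrix_equiv_self e, key, permanent_fromBlocks_zero₂₁]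

/-- For an `(ν+1) × (ν+1)` matrix `X` and a `(μ+2) × (μ+2)` matrix `Z`, both
with entries in `{-1, 0, 1}` and with the bottom-right entry of `Z` equal to `0`, the permanent
of the combined matrix `W` satisfies
`Per(W) = Per(Z)·Per(X^{1,1}) + Per(Z^{m,m})·Per(X)`. -/
theorem stmt1 (ν μ : ℕ) (X : Matrix (Fin (ν + 1)) (Fin (ν + 1)) ℤ)
    (Z : Matrix (Fin (μ + 2)) (Fin (μ + 2)) ℤ)
    (hX : ∀ i j, X i j = -1 ∨ X i j = 0 ∨ X i j = 1)
    (hZ : ∀ i j, Z i j = -1 ∨ Z i j = 0 ∨ Z i j = 1)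
    (hZ0 : Z (Fin.last (μ + 1)) (Fin.last (μ + 1)) = 0) :
    (blockW μ ν Z X).permanent =
      Z.permanent * (matMinor X 0 0).permanent +
        (matMinor Z (Fin.last (μ + 1)) (Fin.last (μ + 1))).permanent * X.permanent := by
  let r : Fin (μ + ν + 2) := ⟨μ + 1, by omega⟩
  rw [← permanent_blockW_updateRow_left μ ν Z X hZ0 r rfl,
    ← permanent_blockW_updateRow_right μ ν Z X r rfl, ← Matrix.permanent_updateRow_add]
  congr 1
  ext i j
  simp only [Matrix.updateRow_apply, Pi.add_apply]
  split_ifs with hi <;> simp [hi]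
end

section
/- Let n ≥ 1, let V = 𝔽₂ⁿ, let f : V → V be injective, let Q ⊆ V, and let s ∈ V with s ≠ 0 be such that q + q' ≠ s for all distinct q, q' ∈ Q. Then there exists a function f' : V → V such that f'(q) = f(q) for every q ∈ Q, and f' is a Simon function with period s: for all x, y ∈ V, f'(x) = f'(y) if and only if y = x or y = x + s. -/
theorem pi_zmod_two_add_self {ι : Type*} (x : ι → ZMod 2) : x + x = 0 :=
  funext fun i => CharTwo.add_self_eq_zero (x i)

/-- Every translation pair `{x, x + s}` has a representative, chosen inside `Q` whenever `Q`
contains at most one point of each pair. -/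
theorem exists_representative_of_period {n : ℕ} (Q : Set (Fin n → ZMod 2))
    (s : Fin n → ZMod 2) (hs : s ≠ 0)
    (hQ : ∀ q ∈ Q, ∀ q' ∈ Q, q ≠ q' → q + q' ≠ s) :
    ∃ r : (Fin n → ZMod 2) → (Fin n → ZMod 2),
      (∀ q ∈ Q, r q = q) ∧ (∀ x, r x = x ∨ r x = x + s) ∧ ∀ x, r (x + s) = r x := by
  classical
  obtain ⟨i, hi⟩ := Function.ne_iff.mp hs
  have add_cancel (x : Fin n → ZMod 2) : x + s + s = x := by
    rw [add_assoc, pi_zmod_two_add_self, add_zero]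
  have not_both (x : Fin n → ZMod 2) (hx : x ∈ Q) : x + s ∉ Q := fun hxs =>
    hQ x hx _ hxs (by simpa using hs)
      (by rw [← add_assoc, pi_zmod_two_add_self, zero_add])
  have coord (x : Fin n → ZMod 2) : (x + s) i = 0 ↔ x i ≠ 0 := by
    have key : ∀ a b : ZMod 2, b ≠ 0 → (a + b = 0 ↔ a ≠ 0) := by decide
    exact key _ _ hi
  refine ⟨fun x => if x ∈ Q then x else if x + s ∈ Q then x + s else
    if x i = 0 then x else x + s, fun q hq => if_pos hq, fun x => ?_, fun x => ?_⟩
  · dsimp only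
    split_ifs <;> simp
  · have hx := not_both x
    simp only [add_cancel, coord]
    split_ifs <;> simp_all

/-- Let `f : 𝔽₂ⁿ → 𝔽₂ⁿ` be injective (`n ≥ 1`), let `Q ⊆ 𝔽₂ⁿ`, and let
`s ≠ 0` be such that no two distinct elements of `Q` sum (XOR) to `s`. Then there is a
function `f'` agreeing with `f` on `Q` which is a Simon function with period `s`:
`f'(x) = f'(y)` iff `y = x` or `y = x + s`. -/
theorem stmt7 (n : ℕ) (hn : 1 ≤ n)
    (f : (Fin n → ZMod 2) → (Fin n → ZMod 2)) (hf : Function.Injective f)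
    (Q : Set (Fin n → ZMod 2)) (s : Fin n → ZMod 2) (hs : s ≠ 0)
    (hQ : ∀ q ∈ Q, ∀ q' ∈ Q, q ≠ q' → q + q' ≠ s) :
    ∃ f' : (Fin n → ZMod 2) → (Fin n → ZMod 2),
      (∀ q ∈ Q, f' q = f q) ∧
      ∀ x y, f' x = f' y ↔ (y = x ∨ y = x + s) := by
  obtain ⟨r, hrQ, hr, hrs⟩ := exists_representative_of_period Q s hs hQ
  refine ⟨f ∘ r, fun q hq => congrArg f (hrQ q hq), fun x y => ⟨fun h => ?_, ?_⟩⟩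
  · have hxy : r x = r y := hf h
    have add_cancel : y + s + s = y := by
      rw [add_assoc, pi_zmod_two_add_self, add_zero]
    rcases hr x with hx | hx <;> rcases hr y with hy | hy <;> rw [hx, hy] at hxy
    · exact Or.inl hxy.symm
    · exact Or.inr (by rw [hxy, add_cancel])
    · exact Or.inr hxy.symm
    · exact Or.inl (add_right_cancel hxy).symm
  · rintro (rfl | rfl)
    · rfl
    · exact congrArg f (hrs x).symm
end
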